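/- arXiv:2107.03643 — 5 statements merged into one kernel-verified Lean document; each statement's English description precedes it below -/
import Mathlib

section
/- Let K be a valued field equipped with an L-structure for some first-order language L expanding the language of valued fields, with a fixed pseudo-uniformizer t and a fixed lift k̃ of the residue field. Let X, X' ⊆ K^n be definable sets, let d, d' be positive integers and N, N', e, e' : ℕ → ℕ functions, and assume the counting dimension of X is bounded by (N, d, e) and the counting dimension of X' is bounded by (N', d', e'). Then the counting dimension of X ∪ X' is bounded by (N + N', max(d, d'), max(e, e')), i.e. by the functions s ↦ N(s) + N'(s), the constant max(d, d'), and s ↦ max(e(s), e'(s)). -/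
open FirstOrder

/-- The set `k̃[t]_s` of polynomials in `t` of degree `< s` with coefficients in
the lift `kt` of the residue field. -/
def ktPoly {K : Type*} [Field K] (kt : Subfield K) (t : K) (s : ℕ) : Set K :=
  {x | ∃ a : Fin s → K, (∀ i, a i ∈ kt) ∧ x = ∑ i, a i * t ^ (i : ℕ)}

/-- `X_s = X ∩ (k̃[t]_s)^n`, the rational points of height at most `s` on `X`. -/
def heightPts {K : Type*} [Field K] {n : ℕ} (kt : Subfield K) (t : K)
    (X : Set (Fin n → K)) (s : ℕ) : Set (Fin n → K) :=
  {x ∈ X | ∀ i, x i ∈ ktPoly kt t s}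

/-- `kt` is a lift of the residue field: it is contained in the valuation ring and the
residue map restricts to a bijection from `kt` to the residue field. -/
def IsLift {K Γ : Type*} [Field K] [LinearOrderedCommGroupWithZero Γ]
    (v : Valuation K Γ) (kt : Subfield K) : Prop :=
  (∀ x ∈ kt, v x ≤ 1) ∧ ∀ x : K, v x ≤ 1 → ∃! a : K, a ∈ kt ∧ v (x - a) < 1

/-- The language `L` expands the language of valued fields `{0, 1, +, ·, O_K}`:
the corresponding basic sets are `∅`-definable (hence definable with parameters). -/
def ExpandsValuedFields {K Γ : Type*} [Field K] [LinearOrderedCommGroupWithZero Γ]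
    (L : Language) [L.Structure K] (v : Valuation K Γ) : Prop :=
  Set.Definable (Set.univ : Set K) L {z : Fin 1 → K | z 0 = 0} ∧
  Set.Definable (Set.univ : Set K) L {z : Fin 1 → K | z 0 = 1} ∧
  Set.Definable (Set.univ : Set K) L {z : Fin 3 → K | z 0 + z 1 = z 2} ∧
  Set.Definable (Set.univ : Set K) L {z : Fin 3 → K | z 0 * z 1 = z 2} ∧
  Set.Definable (Set.univ : Set K) L {z : Fin 1 → K | v (z 0) ≤ 1}

/-- The counting dimension of `X ⊆ K^n` is bounded by `(N, d, e)`: there is a definable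
function `f : X → O_K^d` such that for every positive `s`, the composition of `f` with
componentwise reduction modulo `t^{e s}`, as a map on `X_s`, has all fibres finite of
cardinality at most `N s`. -/
def CDimBounded {K Γ : Type*} [Field K] [LinearOrderedCommGroupWithZero Γ]
    (L : Language) [L.Structure K] (v : Valuation K Γ) (kt : Subfield K) (t : K)
    {n : ℕ} (X : Set (Fin n → K)) (N : ℕ → ℕ) (d : ℕ) (e : ℕ → ℕ) : Prop :=
  ∃ f : (Fin n → K) → (Fin d → K),
    (∀ x ∈ X, ∀ i, v (f x i) ≤ 1) ∧
    Set.Definable (Set.univ : Set K) L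
      {z : Fin (n + d) → K | ∃ x ∈ X, z = Fin.append x (f x)} ∧
    ∀ s : ℕ, 0 < s → ∀ x ∈ heightPts kt t X s,
      {y ∈ heightPts kt t X s | ∀ i, v (f y i - f x i) ≤ v t ^ e s}.Finite ∧
      {y ∈ heightPts kt t X s | ∀ i, v (f y i - f x i) ≤ v t ^ e s}.ncard ≤ N s

/-- Extend a vector of length `d` by zeros to (or truncate it to) a vector of length `m`. -/
def zeroPad {K : Type*} [Zero K] {d : ℕ} (m : ℕ) (u : Fin d → K) : Fin m → K :=
  fun i => if h : (i : ℕ) < d then u ⟨i, h⟩ else 0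

lemma definable_graph_zeroPad {K : Type*} [Zero K] (L : Language) [L.Structure K]
    (hzero : Set.Definable (Set.univ : Set K) L {z : Fin 1 → K | z 0 = 0})
    {n d m : ℕ} (hdm : d ≤ m) {X : Set (Fin n → K)} {f : (Fin n → K) → (Fin d → K)}
    (hf : Set.Definable (Set.univ : Set K) L
      {z : Fin (n + d) → K | ∃ x ∈ X, z = Fin.append x (f x)}) :
    Set.Definable (Set.univ : Set K) L
      {z : Fin (n + m) → K | ∃ x ∈ X, z = Fin.append x (zeroPad m (f x))} := by
  have hgraph := hf.preimage_comp (Fin.castLE (Nat.add_le_add_left hdm n))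
  have htail := Set.definable_biInter_finset
    (f := fun j : Fin m => {z : Fin (n + m) → K | z (Fin.natAdd n j) = 0})
    (fun j => hzero.preimage_comp (fun _ : Fin 1 => Fin.natAdd n j))
    (Finset.univ.filter fun j : Fin m => d ≤ (j : ℕ))
  convert hgraph.inter htail using 1
  ext z
  simp only [Set.mem_setOf_eq, Set.mem_inter_iff, Set.mem_preimage, Set.mem_iInter,
    Finset.mem_filter, Finset.mem_univ, true_and]
  constructor
  · rintro ⟨x, hx, rfl⟩
    refine ⟨⟨x, hx, ?_⟩, fun j hj => ?_⟩
    · funext k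
      refine Fin.addCases (fun i => ?_) (fun j => ?_) k
      · have : Fin.castLE (Nat.add_le_add_left hdm n) (Fin.castAdd d i) = Fin.castAdd m i := rfl
        simp [this]
      · have : Fin.castLE (Nat.add_le_add_left hdm n) (Fin.natAdd n j) =
            Fin.natAdd n (Fin.castLE hdm j) := rfl
        simp [this, zeroPad]
    · simp [zeroPad, hj]
  · rintro ⟨⟨x, hx, hz⟩, h0⟩
    refine ⟨x, hx, ?_⟩
    funext k
    refine Fin.addCases (fun i => ?_) (fun j => ?_) k
    · rw [Fin.append_left]
      exact (congrFun hz (Fin.castAdd d i)).trans (Fin.append_left _ _ _)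
    · by_cases hj : (j : ℕ) < d
      · rw [Fin.append_right, zeroPad, dif_pos hj]
        exact (congrFun hz (Fin.natAdd n ⟨j, hj⟩)).trans (Fin.append_right _ _ _)
      · simpa [zeroPad, hj] using h0 j (not_lt.mp hj)

/-- A bound on the fibres through points of `S` passes to the fibres over arbitrary points of the
zero-padded map, at any finer precision. -/
lemma fibre_zeroPad_finite_ncard_le {K Γ α : Type*} [Field K]
    [LinearOrderedCommGroupWithZero Γ] (v : Valuation K Γ) {d m : ℕ} (hdm : d ≤ m)
    {S : Set α} {f : α → Fin d → K} {r r' : Γ} (hr : r' ≤ r) {B : ℕ}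
    (h : ∀ x ∈ S, {y ∈ S | ∀ i, v (f y i - f x i) ≤ r}.Finite ∧
      {y ∈ S | ∀ i, v (f y i - f x i) ≤ r}.ncard ≤ B) (c : Fin m → K) :
    {y ∈ S | ∀ i, v (zeroPad m (f y) i - c i) ≤ r'}.Finite ∧
      {y ∈ S | ∀ i, v (zeroPad m (f y) i - c i) ≤ r'}.ncard ≤ B := by
  rcases Set.eq_empty_or_nonempty {y ∈ S | ∀ i, v (zeroPad m (f y) i - c i) ≤ r'}
    with hE | ⟨x, hxS, hx⟩
  · simp [hE]
  · obtain ⟨hfin, hcard⟩ := h x hxS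
    have hsub : {y ∈ S | ∀ i, v (zeroPad m (f y) i - c i) ≤ r'} ⊆
        {y ∈ S | ∀ i, v (f y i - f x i) ≤ r} := by
      rintro y ⟨hyS, hy⟩
      refine ⟨hyS, fun i => ?_⟩
      have hyi := hy (Fin.castLE hdm i)
      have hxi := hx (Fin.castLE hdm i)
      simp only [zeroPad, Fin.val_castLE, Fin.is_lt, dite_true, Fin.eta] at hyi hxi
      rw [← sub_sub_sub_cancel_right (f y i) (f x i) (c (Fin.castLE hdm i))]
      exact (v.map_sub_le hyi hxi).trans hr
    exact ⟨hfin.subset hsub, (Set.ncard_le_ncard hsub hfin).trans hcard⟩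

lemma map_zeroPad_le_one {K Γ : Type*} [Field K] [LinearOrderedCommGroupWithZero Γ]
    (v : Valuation K Γ) {d : ℕ} (m : ℕ) {u : Fin d → K} (hu : ∀ i, v (u i) ≤ 1) (i : Fin m) :
    v (zeroPad m u i) ≤ 1 := by
  unfold zeroPad
  split_ifs
  · exact hu _
  · simp

/-- Proposition 2.6(1): the counting dimension of a union `X ∪ X'` is bounded by
`(N + N', max d d', max e e')`. -/
theorem counting_dim_union {K Γ : Type*} [Field K] [LinearOrderedCommGroupWithZero Γ]
    (L : Language) [L.Structure K] (v : Valuation K Γ)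
    (t : K) (ht0 : v t ≠ 0) (ht1 : v t < 1)
    (kt : Subfield K) (hkt : IsLift v kt)
    (hL : ExpandsValuedFields L v)
    {n : ℕ} (X X' : Set (Fin n → K))
    (hX : Set.Definable (Set.univ : Set K) L X)
    (hX' : Set.Definable (Set.univ : Set K) L X')
    (d d' : ℕ) (hd : 0 < d) (hd' : 0 < d')
    (N N' e e' : ℕ → ℕ)
    (hXb : CDimBounded L v kt t X N d e)
    (hX'b : CDimBounded L v kt t X' N' d' e') :
    CDimBounded L v kt t (X ∪ X') (fun s => N s + N' s) (max d d')
      (fun s => max (e s) (e' s)) := by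
  classical
  obtain ⟨f, hf1, hfdef, hf⟩ := hXb
  obtain ⟨f', hf1', hfdef', hf'⟩ := hX'b
  set m := max d d'
  refine ⟨fun x => if x ∈ X then zeroPad m (f x) else zeroPad m (f' x), ?_, ?_, ?_⟩
  · intro x hx i
    by_cases hxX : x ∈ X
    · simpa [hxX] using map_zeroPad_le_one v m (hf1 x hxX) i
    · simpa [hxX] using map_zeroPad_le_one v m (hf1' x (hx.resolve_left hxX)) i
  · have hG := definable_graph_zeroPad L hL.1 (le_max_left d d') hfdef
    have hG' := definable_graph_zeroPad L hL.1 (le_max_right d d') hfdef'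
    have hXc := hX.compl.preimage_comp (Fin.castAdd (n := n) m)
    convert hG.union (hG'.inter hXc) using 1
    have hcomp (x : Fin n → K) (w : Fin m → K) : Fin.append x w ∘ Fin.castAdd m = x := by
      funext i
      simp
    ext z
    constructor
    · rintro ⟨x, hx, rfl⟩
      by_cases hxX : x ∈ X
      · exact Or.inl ⟨x, hxX, by simp [hxX, m]⟩
      · exact Or.inr ⟨⟨x, hx.resolve_left hxX, by simp [hxX, m]⟩, by
          simpa [hcomp] using hxX⟩
    · rintro (⟨x, hx, rfl⟩ | ⟨⟨x, hx, rfl⟩, hxX⟩)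
      · exact ⟨x, Or.inl hx, by simp [hx, m]⟩
      · have hxX' : x ∉ X := by
          rw [Set.mem_preimage, hcomp] at hxX
          exact hxX
        exact ⟨x, Or.inr hx, by simp [hxX', m]⟩
  · intro s hs x _
    set g : (Fin n → K) → Fin m → K :=
      fun x => if x ∈ X then zeroPad m (f x) else zeroPad m (f' x)
    obtain ⟨hfin, hcard⟩ := fibre_zeroPad_finite_ncard_le v (le_max_left d d')
      (pow_le_pow_right_of_le_one' ht1.le (le_max_left (e s) (e' s))) (hf s hs) (g x)
    obtain ⟨hfin', hcard'⟩ := fibre_zeroPad_finite_ncard_le v (le_max_right d d')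
      (pow_le_pow_right_of_le_one' ht1.le (le_max_right (e s) (e' s))) (hf' s hs) (g x)
    have hsub : {y ∈ heightPts kt t (X ∪ X') s |
          ∀ i, v (g y i - g x i) ≤ v t ^ max (e s) (e' s)} ⊆
        {y ∈ heightPts kt t X s |
          ∀ i, v (zeroPad m (f y) i - g x i) ≤ v t ^ max (e s) (e' s)} ∪
        {y ∈ heightPts kt t X' s |
          ∀ i, v (zeroPad m (f' y) i - g x i) ≤ v t ^ max (e s) (e' s)} := by
      rintro y ⟨⟨hyX, hyp⟩, hy⟩
      by_cases hyX0 : y ∈ X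
      · have hgy : g y = zeroPad m (f y) := if_pos hyX0
        exact Or.inl ⟨⟨hyX0, hyp⟩, hgy ▸ hy⟩
      · have hgy : g y = zeroPad m (f' y) := if_neg hyX0
        exact Or.inr ⟨⟨hyX.resolve_left hyX0, hyp⟩, hgy ▸ hy⟩
    refine ⟨(hfin.union hfin').subset hsub, ?_⟩
    exact (Set.ncard_le_ncard hsub (hfin.union hfin')).trans
      ((Set.ncard_union_le _ _).trans (Nat.add_le_add hcard hcard'))
end

section
/- Let K be a valued field equipped with an L-structure for some first-order language L expanding the language of valued fields, with a fixed pseudo-uniformizer t and a fixed lift k̃ of the residue field. Let X, X' ⊆ K^n be definable sets, let d, d' be positive integers and N, N', e, e' : ℕ → ℕ functions, and assume the counting dimension of X is bounded by (N, d, e) and the counting dimension of X' is bounded by (N', d', e'). Then the counting dimension of the product X × X' ⊆ K^{2n} is bounded by (N·N', d + d', max(e, e')), i.e. by the functions s ↦ N(s)·N'(s), the constant d + d', and s ↦ max(e(s), e'(s)). -/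
open FirstOrder

theorem Fin.eq_append_iff {α : Type*} {m n : ℕ} {z : Fin (m + n) → α} {x : Fin m → α}
    {y : Fin n → α} :
    z = Fin.append x y ↔ (z ∘ Fin.castAdd n = x) ∧ (z ∘ Fin.natAdd m = y) := by
  constructor
  · rintro rfl
    exact ⟨funext fun i => Fin.append_left x y i, funext fun i => Fin.append_right x y i⟩
  · rintro ⟨rfl, rfl⟩
    funext i
    refine Fin.addCases (fun i => ?_) (fun i => ?_) i <;> simp

/-- The components of a point of height at most `s` on a product have height at most `s`. -/
theorem heightPts_append {K : Type*} [Field K] {m n : ℕ} (kt : Subfield K) (t : K)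
    (X : Set (Fin m → K)) (Y : Set (Fin n → K)) (s : ℕ) (z : Fin (m + n) → K)
    (hz : z ∈ heightPts kt t {z | ∃ x ∈ X, ∃ y ∈ Y, z = Fin.append x y} s) :
    z ∘ Fin.castAdd n ∈ heightPts kt t X s ∧ z ∘ Fin.natAdd m ∈ heightPts kt t Y s := by
  obtain ⟨⟨x, hx, y, hy, h⟩, hs⟩ := hz
  obtain ⟨rfl, rfl⟩ := Fin.eq_append_iff.1 h
  exact ⟨⟨hx, fun i => hs _⟩, ⟨hy, fun i => hs _⟩⟩

/-- Proposition 2.6(2): the counting dimension of a product `X × X' ⊆ K^{2n}` is bounded by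
`(N·N', d + d', max e e')`. -/
theorem counting_dim_prod {K Γ : Type*} [Field K] [LinearOrderedCommGroupWithZero Γ]
    (L : Language) [L.Structure K] (v : Valuation K Γ)
    (t : K) (ht0 : v t ≠ 0) (ht1 : v t < 1)
    (kt : Subfield K) (hkt : IsLift v kt)
    (hL : ExpandsValuedFields L v)
    {n : ℕ} (X X' : Set (Fin n → K))
    (hX : Set.Definable (Set.univ : Set K) L X)
    (hX' : Set.Definable (Set.univ : Set K) L X')
    (d d' : ℕ) (hd : 0 < d) (hd' : 0 < d')
    (N N' e e' : ℕ → ℕ)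
    (hXb : CDimBounded L v kt t X N d e)
    (hX'b : CDimBounded L v kt t X' N' d' e') :
    CDimBounded L v kt t
      {z : Fin (n + n) → K | ∃ x ∈ X, ∃ y ∈ X', z = Fin.append x y}
      (fun s => N s * N' s) (d + d') (fun s => max (e s) (e' s)) := by
  obtain ⟨f, hf, hfdef, hfib⟩ := hXb
  obtain ⟨g, hg, hgdef, hgib⟩ := hX'b
  refine ⟨fun z => Fin.append (f (z ∘ Fin.castAdd n)) (g (z ∘ Fin.natAdd n)), ?_, ?_, ?_⟩
  · rintro z ⟨x, hx, y, hy, h⟩ i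
    obtain ⟨rfl, rfl⟩ := Fin.eq_append_iff.1 h
    refine Fin.addCases (fun i => ?_) (fun i => ?_) i
    · simpa using hf _ hx i
    · simpa using hg _ hy i
  · have h1 := hfdef.preimage_comp
      (Fin.append (Fin.castAdd (d + d') ∘ Fin.castAdd n) (Fin.natAdd (n + n) ∘ Fin.castAdd d'))
    have h2 := hgdef.preimage_comp
      (Fin.append (Fin.castAdd (d + d') ∘ Fin.natAdd n) (Fin.natAdd (n + n) ∘ Fin.natAdd d))
    convert h1.inter h2 using 1
    ext z
    constructor
    · rintro ⟨w, ⟨x, hx, y, hy, hw⟩, rfl⟩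
      obtain ⟨rfl, rfl⟩ := Fin.eq_append_iff.1 hw
      refine ⟨⟨_, hx, Fin.eq_append_iff.2 ⟨?_, ?_⟩⟩, ⟨_, hy, Fin.eq_append_iff.2 ⟨?_, ?_⟩⟩⟩ <;>
        funext i <;> simp
    · rintro ⟨⟨x, hx, hzx⟩, ⟨y, hy, hzy⟩⟩
      obtain ⟨hx₁, hx₂⟩ := Fin.eq_append_iff.1 hzx
      obtain ⟨hy₁, hy₂⟩ := Fin.eq_append_iff.1 hzy
      simp only [funext_iff, Function.comp_apply, Fin.append_left, Fin.append_right]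
        at hx₁ hx₂ hy₁ hy₂
      obtain ⟨hwx, hwy⟩ := Fin.eq_append_iff.1 (rfl : Fin.append x y = Fin.append x y)
      refine ⟨Fin.append x y, ⟨x, hx, y, hy, rfl⟩, ?_⟩
      beta_reduce
      rw [hwx, hwy]
      refine Fin.eq_append_iff.2 ⟨Fin.eq_append_iff.2 ⟨?_, ?_⟩, Fin.eq_append_iff.2 ⟨?_, ?_⟩⟩
      · exact funext hx₁
      · exact funext hy₁
      · exact funext hx₂
      · exact funext hy₂
  · intro s hs z hz
    obtain ⟨hzx, hzy⟩ := heightPts_append kt t X X' s z hz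
    obtain ⟨hA, hAN⟩ := hfib s hs _ hzx
    obtain ⟨hB, hBN⟩ := hgib s hs _ hzy
    set A := {y ∈ heightPts kt t X s | ∀ i, v (f y i - f (z ∘ Fin.castAdd n) i) ≤ v t ^ e s}
    set B := {y ∈ heightPts kt t X' s | ∀ i, v (g y i - g (z ∘ Fin.natAdd n) i) ≤ v t ^ e' s}
    have hsub : {y ∈ heightPts kt t {z | ∃ x ∈ X, ∃ y ∈ X', z = Fin.append x y} s |
        ∀ i, v (Fin.append (f (y ∘ Fin.castAdd n)) (g (y ∘ Fin.natAdd n)) i -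
          Fin.append (f (z ∘ Fin.castAdd n)) (g (z ∘ Fin.natAdd n)) i) ≤ v t ^ max (e s) (e' s)} ⊆
        (fun p : (Fin n → K) × (Fin n → K) => Fin.append p.1 p.2) '' (A ×ˢ B) := by
      rintro w ⟨hw, hwv⟩
      obtain ⟨hwx, hwy⟩ := heightPts_append kt t X X' s w hw
      refine ⟨(w ∘ Fin.castAdd n, w ∘ Fin.natAdd n), ⟨⟨hwx, fun i => ?_⟩, ⟨hwy, fun i => ?_⟩⟩,
        (Fin.eq_append_iff.2 ⟨rfl, rfl⟩).symm⟩
      · have h := hwv (Fin.castAdd d' i)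
        rw [Fin.append_left, Fin.append_left] at h
        exact h.trans (pow_le_pow_right_of_le_one' ht1.le (le_max_left _ _))
      · have h := hwv (Fin.natAdd d i)
        rw [Fin.append_right, Fin.append_right] at h
        exact h.trans (pow_le_pow_right_of_le_one' ht1.le (le_max_right _ _))
    have hfin := (hA.prod hB).image (fun p : (Fin n → K) × (Fin n → K) => Fin.append p.1 p.2)
    refine ⟨hfin.subset hsub, (Set.ncard_le_ncard hsub hfin).trans ?_⟩
    refine (Set.ncard_image_le (hA.prod hB)).trans ?_
    rw [Set.ncard_prod]
    exact Nat.mul_le_mul hAN hBN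
end

section
/- Fix integers n > m ≥ 1. For each positive integer d set μ(n,d) = D_n(d), let r(m,d) be the unique integer r with D_m(r−1) ≤ μ(n,d) < D_m(r), and set V(n,d) = Σ_{k=0}^{d} k·L_n(k) and e(n,m,d) = Σ_{k=1}^{r(m,d)−1} k·L_m(k) + r(m,d)·(μ(n,d) − D_m(r(m,d)−1)). Then the ratio V(n,d)/e(n,m,d) tends to 0 as d tends to infinity. -/
/-- The set `Δ_m(k)` of multi-indices in `ℕ^m` of total degree at most `k`
(coded with coordinates in `Fin (k+1)` to make it a finite type). -/
abbrev DeltaIdx (m k : ℕ) : Type :=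
  {α : Fin m → Fin (k + 1) // ∑ i, (α i : ℕ) ≤ k}

/-- `L_m(k)`, the number of multi-indices in `ℕ^m` of total degree exactly `k`,
i.e. the number of monomials of degree exactly `k` in `m` variables. -/
def Lnum (m k : ℕ) : ℕ :=
  Fintype.card {α : Fin m → Fin (k + 1) // ∑ i, (α i : ℕ) = k}

/-- `D_m(k)`, the number of multi-indices in `ℕ^m` of total degree at most `k`,
i.e. the number of monomials of degree at most `k` in `m` variables. -/
def Dnum (m k : ℕ) : ℕ := Fintype.card (DeltaIdx m k)

/-- In a linearly ordered commutative group with zero, `0` is a bottom element. -/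
noncomputable instance instOrderBotOfLinearOrderedCommGroupWithZero
    {Γ : Type*} [LinearOrderedCommGroupWithZero Γ] : OrderBot Γ where
  bot := 0
  bot_le _ := zero_le'

/-- `ψ : U ⊆ K^m → K` satisfies `T_r`-approximation: for each `y ∈ U` there is a
polynomial `T_y` of total degree `< r` with coefficients in the valuation ring such that
`|ψ(x) − T_y(x)| ≤ |x − y|^r` for all `x ∈ U`, with the maximum norm on `K^m`. -/
def TrApprox {K Γ : Type*} [Field K] [LinearOrderedCommGroupWithZero Γ]
    (v : Valuation K Γ) {m : ℕ} (U : Set (Fin m → K))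
    (ψ : (Fin m → K) → K) (r : ℕ) : Prop :=
  ∀ y ∈ U, ∃ T : MvPolynomial (Fin m) K,
    T.totalDegree < r ∧ (∀ c, v (T.coeff c) ≤ 1) ∧
    ∀ x ∈ U, v (ψ x - MvPolynomial.eval x T) ≤ (Finset.univ.sup fun i => v (x i - y i)) ^ r

/-- `r(m, μ)`: the unique integer `r` with `D_m(r−1) ≤ μ < D_m(r)`, defined as the least
`r` with `μ < D_m(r)`. -/
noncomputable def rfun (m μ : ℕ) : ℕ := sInf {x : ℕ | μ < Dnum m x}

/-- `V(n,d) = Σ_{k=0}^{d} k·L_n(k)`. -/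
def Vfun (n d : ℕ) : ℕ := ∑ k ∈ Finset.range (d + 1), k * Lnum n k

/-- `e(n,m,d) = Σ_{k=1}^{r−1} k·L_m(k) + r·(μ − D_m(r−1))` where `μ = D_n(d)` and
`r = r(m,d)`. -/
noncomputable def efun (n m d : ℕ) : ℕ :=
  (∑ k ∈ Finset.Icc 1 (rfun m (Dnum n d) - 1), k * Lnum m k) +
    rfun m (Dnum n d) * (Dnum n d - Dnum m (rfun m (Dnum n d) - 1))

theorem Dnum_eq_ncard (m k : ℕ) : Dnum m k = {α : Fin m → ℕ | ∑ i, α i ≤ k}.ncard := by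
  rw [Dnum, ← Nat.card_eq_fintype_card]
  refine Nat.card_congr
    { toFun := fun α => ⟨fun i => (α.1 i : ℕ), α.2⟩
      invFun := fun α => ⟨fun i => ⟨α.1 i, Nat.lt_succ_of_le
        ((Finset.single_le_sum (fun _ _ => Nat.zero_le _) (Finset.mem_univ i)).trans α.2)⟩, α.2⟩
      left_inv := fun _ => rfl
      right_inv := fun _ => rfl }

theorem Lnum_eq_ncard (m k : ℕ) : Lnum m k = {α : Fin m → ℕ | ∑ i, α i = k}.ncard := by
  rw [Lnum, ← Nat.card_eq_fintype_card]
  refine Nat.card_congr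
    { toFun := fun α => ⟨fun i => (α.1 i : ℕ), α.2⟩
      invFun := fun α => ⟨fun i => ⟨α.1 i, Nat.lt_succ_of_le
        ((Finset.single_le_sum (fun _ _ => Nat.zero_le _) (Finset.mem_univ i)).trans
          (le_of_eq α.2))⟩, α.2⟩
      left_inv := fun _ => rfl
      right_inv := fun _ => rfl }

theorem finite_setOf_sum_le (m k : ℕ) : {α : Fin m → ℕ | ∑ i, α i ≤ k}.Finite :=
  (Set.Finite.pi' fun _ : Fin m => Set.finite_Iic k).subset fun _ hα i =>
    (Finset.single_le_sum (fun _ _ => Nat.zero_le _) (Finset.mem_univ i)).trans hα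

theorem Dnum_succ (m k : ℕ) : Dnum m (k + 1) = Dnum m k + Lnum m (k + 1) := by
  have hfin : {α : Fin m → ℕ | ∑ i, α i = k + 1}.Finite :=
    (finite_setOf_sum_le m (k + 1)).subset fun _ h => le_of_eq h
  rw [Dnum_eq_ncard, Dnum_eq_ncard, Lnum_eq_ncard,
    ← Set.ncard_union_eq ?_ (finite_setOf_sum_le m k) hfin]
  · congr 1
    ext α
    simp only [Set.mem_ofPred_eq, Set.mem_union]
    omega
  · refine Set.disjoint_left.2 fun α h h' => ?_
    simp only [Set.mem_ofPred_eq] at h h'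
    omega

theorem Dnum_mono (m : ℕ) : Monotone (Dnum m) :=
  monotone_nat_of_le_succ fun k => by rw [Dnum_succ]; exact Nat.le_add_right _ _

theorem Dnum_le_pow (m k : ℕ) : Dnum m k ≤ (k + 1) ^ m := by
  refine (Fintype.card_subtype_le _).trans ?_
  simp

theorem pow_le_Dnum_mul (m k : ℕ) : k ^ m ≤ Dnum m k * m ^ m := by
  have h : (k / m + 1) ^ m ≤ Dnum m k := by
    have hcard : (k / m + 1) ^ m = Fintype.card (Fin m → Fin (k / m + 1)) := by simp
    rw [hcard, Dnum]
    have hle : k / m + 1 ≤ k + 1 := Nat.succ_le_succ (Nat.div_le_self k m)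
    refine Fintype.card_le_of_injective
      (fun α => ⟨fun i => Fin.castLE hle (α i), ?_⟩) fun α β hαβ => ?_
    · calc ∑ i, ((Fin.castLE hle (α i) : Fin (k + 1)) : ℕ)
          ≤ ∑ _i : Fin m, k / m :=
            Finset.sum_le_sum fun i _ => Nat.le_of_lt_succ (α i).isLt
        _ ≤ k := by simpa using Nat.mul_div_le k m
    · funext i
      exact Fin.castLE_injective hle (congrFun (congrArg Subtype.val hαβ) i)
  rcases Nat.eq_zero_or_pos m with rfl | hm
  · simpa using h
  calc k ^ m ≤ ((k / m + 1) * m) ^ m := Nat.pow_le_pow_left (Nat.lt_div_mul_add hm |>.le.trans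
        (by rw [Nat.add_mul, Nat.one_mul])) m
    _ = (k / m + 1) ^ m * m ^ m := Nat.mul_pow _ _ _
    _ ≤ Dnum m k * m ^ m := Nat.mul_le_mul_right _ h

theorem lt_Dnum_rfun {m : ℕ} (hm : 1 ≤ m) (μ : ℕ) : μ < Dnum m (rfun m μ) := by
  refine Nat.sInf_mem (s := {x : ℕ | μ < Dnum m x}) ⟨μ * m ^ m + 1, ?_⟩
  have h := (Nat.le_self_pow (by omega) (μ * m ^ m + 1)).trans
    (pow_le_Dnum_mul m (μ * m ^ m + 1))
  exact lt_of_mul_lt_mul_right (Nat.lt_of_succ_le h) (Nat.zero_le _)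

theorem Dnum_le_of_lt_rfun {m μ x : ℕ} (h : x < rfun m μ) : Dnum m x ≤ μ :=
  not_lt.1 (Nat.notMem_of_lt_sInf (s := {x : ℕ | μ < Dnum m x}) h)

theorem mul_Dnum_le_sum_add (m K N : ℕ) :
    K * Dnum m N ≤ ∑ k ∈ Finset.Icc 1 N, k * Lnum m k + K * Dnum m K := by
  rcases le_total N K with h | h
  · exact (Nat.mul_le_mul_left K (Dnum_mono m h)).trans (Nat.le_add_left _ _)
  · induction N, h using Nat.le_induction with
    | base => exact Nat.le_add_left _ _
    | succ N hN ih =>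
      rw [Finset.sum_Icc_succ_top (by omega), Dnum_succ]
      nlinarith [Nat.mul_le_mul_right (Lnum m (N + 1)) (hN.trans N.le_succ)]

theorem mul_Dnum_le_efun_add {m : ℕ} (hm : 1 ≤ m) (n d K : ℕ) :
    K * Dnum n d ≤ efun n m d + K * Dnum m K := by
  rcases lt_or_ge (Dnum n d) (Dnum m K) with h | h
  · exact (Nat.mul_le_mul_left K h.le).trans (Nat.le_add_left _ _)
  · have hK : K < rfun m (Dnum n d) := by
      by_contra! hr
      exact absurd (lt_Dnum_rfun hm (Dnum n d)) (not_lt.2 ((Dnum_mono m hr).trans h))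
    unfold efun
    have hr : rfun m (Dnum n d) - 1 < rfun m (Dnum n d) := by omega
    obtain ⟨t, ht⟩ := Nat.exists_eq_add_of_le (Dnum_le_of_lt_rfun hr)
    have h₁ := mul_Dnum_le_sum_add m K (rfun m (Dnum n d) - 1)
    have h₂ : Dnum n d - Dnum m (rfun m (Dnum n d) - 1) = t := by omega
    rw [h₂]
    calc K * Dnum n d = K * Dnum m (rfun m (Dnum n d) - 1) + K * t := by
          rw [← Nat.mul_add, ← ht]
      _ ≤ _ := by linarith [Nat.mul_le_mul_right t hK.le]

theorem Vfun_le (n d : ℕ) : Vfun n d ≤ d * Dnum n d := by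
  induction d with
  | zero => simp [Vfun]
  | succ d ih =>
    have h : Vfun n (d + 1) = Vfun n d + (d + 1) * Lnum n (d + 1) :=
      Finset.sum_range_succ _ _
    rw [h, Dnum_succ]
    nlinarith

theorem mul_Vfun_le_two_mul_efun {n m : ℕ} (hm : 1 ≤ m) (hmn : m < n) (C d : ℕ)
    (hd : 2 * (C + 1) ^ m * n ^ n ≤ d) : C * Vfun n d ≤ 2 * efun n m d := by
  have hnn : 0 < n ^ n := Nat.pow_pos (by omega)
  have hd₁ : 1 ≤ d := le_trans (Nat.succ_le_of_lt (by positivity)) hd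
  have hD : 2 * Dnum m (C * d) ≤ Dnum n d := by
    refine le_of_mul_le_mul_right ?_ hnn
    calc 2 * Dnum m (C * d) * n ^ n ≤ 2 * ((C + 1) * d) ^ m * n ^ n := by
          gcongr
          exact (Dnum_le_pow _ _).trans (Nat.pow_le_pow_left (by linarith) m)
      _ = (2 * (C + 1) ^ m * n ^ n) * d ^ m := by rw [Nat.mul_pow]; ring
      _ ≤ d * d ^ m := Nat.mul_le_mul_right _ hd
      _ = d ^ (m + 1) := by ring
      _ ≤ d ^ n := Nat.pow_le_pow_right hd₁ hmn
      _ ≤ Dnum n d * n ^ n := pow_le_Dnum_mul n d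
  have h₁ := mul_Dnum_le_efun_add hm n d (C * d)
  have h₂ := Nat.mul_le_mul_left C (Vfun_le n d)
  have h₃ := Nat.mul_le_mul_left (C * d) hD
  linarith

/-- For fixed `n > m ≥ 1`, the ratio `V(n,d)/e(n,m,d)` tends to `0` as `d → ∞`. -/
theorem vfun_div_efun_tendsto_zero (n m : ℕ) (hm : 1 ≤ m) (hmn : m < n) :
    Filter.Tendsto (fun d : ℕ => (Vfun n d : ℝ) / (efun n m d : ℝ))
      Filter.atTop (nhds 0) := by
  rw [Metric.tendsto_atTop]
  intro ε hε
  obtain ⟨C, hC⟩ := exists_nat_gt (2 / ε)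
  refine ⟨2 * (C + 1) ^ m * n ^ n, fun d hd => ?_⟩
  have hC₀ : (0 : ℝ) < C := (div_pos two_pos hε).trans hC
  have h : (C : ℝ) * Vfun n d ≤ 2 * efun n m d := by
    exact_mod_cast mul_Vfun_le_two_mul_efun hm hmn C d hd
  rw [Real.dist_eq, sub_zero, abs_of_nonneg (by positivity)]
  refine lt_of_le_of_lt (div_le_of_le_mul₀ (c := 2 / (C : ℝ)) ?_ ?_ ?_)
    ((div_lt_comm₀ hε hC₀).1 hC)
  · positivity
  · positivity
  · rw [div_mul_eq_mul_div, le_div_iff₀ hC₀]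
    linarith
end

section
/- Let K be a henselian valued field of equicharacteristic 0 (i.e. K and its residue field both have characteristic 0 and the valuation ring O_K is a henselian local ring), with a fixed pseudo-uniformizer t and a fixed lift k̃ of the residue field. Fix integers d ≥ 1 and n > m ≥ 1, and let μ = D_n(d), let r be the integer with D_m(r−1) ≤ μ < D_m(r), V = Σ_{k=0}^{d} k·L_n(k), and e = Σ_{k=1}^{r−1} k·L_m(k) + r·(μ − D_m(r−1)). Let s be a positive integer, let U ⊆ O_K^m, and suppose ψ = (ψ_1, …, ψ_n) : U → O_K^n satisfies T_r-approximation. Let α be a positive integer with α > sV/e, and let p : O_K^m → (O_K/(t^α))^m be the componentwise reduction map modulo t^α. Then for every fibre B of p, the set ψ(B ∩ U)_s = ψ(B ∩ U) ∩ (k̃[t]_s)^n is contained in an algebraic hypersurface of degree at most d; that is, there exists a nonzero polynomial H ∈ K[x_1, …, x_n] of total degree at most d vanishing at every point of ψ(B ∩ U) ∩ (k̃[t]_s)^n. -/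
section Helpers

open Finset

theorem sum_degree_deltaIdx (m K : ℕ) :
    ∑ γ : DeltaIdx m K, ∑ i, (γ.1 i : ℕ) = ∑ k ∈ range (K + 1), k * Lnum m k := by
  rw [← sum_fiberwise_of_maps_to (t := range (K + 1)) (g := fun γ : DeltaIdx m K ↦ ∑ i, (γ.1 i : ℕ))
    (fun γ _ ↦ by have := γ.2; simp only [mem_range]; omega)]
  refine sum_congr rfl fun k hk ↦ ?_
  have hk' : k ≤ K := by simpa [Nat.lt_succ_iff] using hk
  rw [sum_congr rfl (g := fun _ ↦ k) (fun γ hγ ↦ (mem_filter.1 hγ).2), sum_const, smul_eq_mul,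
    mul_comm]
  congr 1
  rw [← Fintype.card_subtype]
  symm
  refine Fintype.card_of_bijective
    (f := fun α ↦ ⟨⟨fun i ↦ ⟨α.1 i, lt_of_lt_of_le (α.1 i).2 (by omega)⟩, ?_⟩, ?_⟩) ⟨?_, ?_⟩
  · exact α.2.le.trans hk'
  · exact α.2
  · intro α α' h
    ext i
    have := congrFun (congrArg (fun z ↦ z.1.1) h) i
    simpa [Fin.ext_iff] using this
  · rintro ⟨γ, hγ⟩
    refine ⟨⟨fun i ↦ ⟨γ.1 i, ?_⟩, hγ⟩, rfl⟩
    have := single_le_sum (f := fun i ↦ (γ.1 i : ℕ)) (fun _ _ ↦ Nat.zero_le _) (mem_univ i)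
    omega

/-- The exponent vector of a multi-index in `Δ_m(k)`. -/
noncomputable def DeltaIdx.exponent {m k : ℕ} (γ : DeltaIdx m k) : Fin m →₀ ℕ :=
  Finsupp.equivFunOnFinite.symm fun i ↦ (γ.1 i : ℕ)

theorem DeltaIdx.exponent_injective {m k : ℕ} :
    Function.Injective (DeltaIdx.exponent : DeltaIdx m k → Fin m →₀ ℕ) := by
  intro γ γ' h
  ext i
  exact DFunLike.congr_fun h i

theorem DeltaIdx.exists_exponent_eq {m k : ℕ} (γ : Fin m →₀ ℕ) (h : ∑ i, γ i ≤ k) :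
    ∃ γ' : DeltaIdx m k, DeltaIdx.exponent γ' = γ := by
  refine ⟨⟨fun i ↦ ⟨γ i, ?_⟩, h⟩, ?_⟩
  · have := single_le_sum (f := fun i ↦ γ i) (fun _ _ ↦ Nat.zero_le _) (mem_univ i)
    omega
  · ext i
    rfl

/-- If all evaluation determinants on a set vanish, the evaluation vectors satisfy a common
nontrivial linear relation. -/
theorem exists_linear_relation_of_det_eq_zero {K J P : Type*} [Field K] [Fintype J] [DecidableEq J]
    (φ : P → J → K) (h : ∀ z : J → P, Matrix.det (Matrix.of fun j ↦ φ (z j)) = 0) :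
    ∃ a : J → K, a ≠ 0 ∧ ∀ z, ∑ β, a β * φ z β = 0 := by
  have hlt : Submodule.span K (Set.range φ) < ⊤ := by
    refine lt_top_iff_ne_top.2 fun htop ↦ ?_
    obtain ⟨b, hbs, hspan, hli⟩ := exists_linearIndependent K (Set.range φ)
    let B : Module.Basis b K (J → K) := Module.Basis.mk hli (by simp [hspan, htop])
    let e : J ≃ b := (Pi.basisFun K J).indexEquiv B
    choose z hz using fun j ↦ hbs (e j).2
    have hli' : LinearIndependent K (Matrix.of fun j ↦ φ (z j)).row := by
      have : (Matrix.of fun j ↦ φ (z j)).row = fun j ↦ ((e j : b) : J → K) := by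
        funext j
        exact hz j
      rw [this]
      exact hli.comp e e.injective
    have hu := (Matrix.linearIndependent_rows_iff_isUnit).1 hli'
    rw [Matrix.isUnit_iff_isUnit_det, h z] at hu
    exact not_isUnit_zero hu
  obtain ⟨f, hf, hle⟩ := Submodule.exists_le_ker_of_lt_top _ hlt
  have key : ∀ x : J → K, f x = ∑ β, f (Pi.single β 1) * x β := by
    intro x
    conv_lhs => rw [pi_eq_sum_univ' x]
    simp [mul_comm]
  refine ⟨fun β ↦ f (Pi.single β 1), fun h0 ↦ hf ?_, fun z ↦ ?_⟩
  · ext β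
    simpa using congrFun h0 β
  · rw [← key]
    exact hle (Submodule.subset_span ⟨z, rfl⟩)

section Valuation

variable {K Γ : Type*} [Field K] [LinearOrderedCommGroupWithZero Γ] (v : Valuation K Γ)

theorem valuation_det_le {J : Type*} [Fintype J] [DecidableEq J] {τ : Γ} (hτ : τ ≤ 1)
    (w : J → ℕ) {e : ℕ} (he : e ≤ ∑ j, w j) (M : Matrix J J K)
    (hM : ∀ i j, v (M i j) ≤ τ ^ w i) : v M.det ≤ τ ^ e := by
  rw [← Matrix.det_transpose, Matrix.det_apply]
  refine v.map_sum_le fun σ _ ↦ ?_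
  have h1 : v (Equiv.Perm.sign σ • ∏ i, M.transpose (σ i) i) = v (∏ i, M.transpose (σ i) i) := by
    rcases Int.units_eq_one_or (Equiv.Perm.sign σ) with h | h <;> simp [h, Units.smul_def]
  rw [h1, map_prod]
  calc ∏ i, v (M.transpose (σ i) i) ≤ ∏ i, τ ^ w i :=
        prod_le_prod' fun i _ ↦ hM _ _
    _ = τ ^ ∑ i, w i := by rw [prod_pow_eq_pow_sum]
    _ ≤ τ ^ e := pow_le_pow_right_of_le_one' hτ he

/-- Determinant of a product of an integral matrix with a matrix whose rows are small: only
injective choices of rows contribute. -/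
theorem valuation_det_sum_le {I J : Type*} [Fintype I] [Fintype J] [DecidableEq J] {τ : Γ}
    (hτ : τ ≤ 1) (wt : I → ℕ) {e : ℕ}
    (he : ∀ f : J → I, Function.Injective f → e ≤ ∑ j, wt (f j))
    (c : J → I → K) (hc : ∀ j κ, v (c j κ) ≤ 1)
    (w : I → J → K) (hw : ∀ κ j, v (w κ j) ≤ τ ^ wt κ) :
    v (Matrix.det (Matrix.of fun β j ↦ ∑ κ, c β κ * w κ j)) ≤ τ ^ e := by
  classical
  have h1 : (Matrix.of fun β j ↦ ∑ κ, c β κ * w κ j : Matrix J J K) =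
      fun β ↦ ∑ κ, c β κ • w κ := by
    funext β j
    simp [Finset.sum_apply]
  have h2 : Matrix.det (Matrix.of fun β j ↦ ∑ κ, c β κ * w κ j) =
      ∑ f : J → I, (∏ β, c β (f β)) * Matrix.det (Matrix.of fun β ↦ w (f β)) := by
    rw [h1]
    have := (Matrix.detRowAlternating (n := J) (R := K)).toMultilinearMap.map_sum
      (fun β κ ↦ c β κ • w κ)
    refine Eq.trans this (sum_congr rfl fun f _ ↦ ?_)
    exact (Matrix.detRowAlternating (n := J) (R := K)).toMultilinearMap.map_smul_univ
      (fun β ↦ c β (f β)) (fun β ↦ w (f β))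
  rw [h2]
  refine v.map_sum_le fun f _ ↦ ?_
  by_cases hf : Function.Injective f
  · rw [map_mul, map_prod]
    calc (∏ β, v (c β (f β))) * v (Matrix.det (Matrix.of fun β ↦ w (f β)))
        ≤ 1 * τ ^ e := by
          refine mul_le_mul' (prod_le_one' fun β _ ↦ hc _ _) ?_
          exact valuation_det_le v hτ (fun β ↦ wt (f β)) (he f hf) _ fun β j ↦ hw _ _
      _ = τ ^ e := one_mul _
  · obtain ⟨a, b, hab, hne⟩ : ∃ a b, f a = f b ∧ a ≠ b := by
      simpa [Function.Injective] using hf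
    rw [Matrix.det_zero_of_row_eq hne (by funext j; simp [hab])]
    simp

theorem valuation_prod_sub_prod_le {ι : Type*} (S : Finset ι) {ε : Γ} (a b : ι → K)
    (ha : ∀ i, v (a i) ≤ 1) (hb : ∀ i, v (b i) ≤ 1) (hab : ∀ i, v (a i - b i) ≤ ε) :
    v (∏ i ∈ S, a i - ∏ i ∈ S, b i) ≤ ε := by
  classical
  induction S using Finset.induction_on with
  | empty => simp
  | insert i S hi ih =>
    rw [prod_insert hi, prod_insert hi,
      show a i * ∏ j ∈ S, a j - b i * ∏ j ∈ S, b j =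
        a i * (∏ j ∈ S, a j - ∏ j ∈ S, b j) + (a i - b i) * ∏ j ∈ S, b j by ring]
    refine v.map_add_le ?_ ?_
    · rw [map_mul]
      exact (mul_le_of_le_one_left' (ha i)).trans ih
    · rw [map_mul, map_prod]
      exact (mul_le_of_le_one_right' (prod_le_one' fun j _ ↦ hb j)).trans
        (hab i)

theorem valuation_pow_sub_pow_le {ε : Γ} (k : ℕ) (a b : K)
    (ha : v a ≤ 1) (hb : v b ≤ 1) (hab : v (a - b) ≤ ε) : v (a ^ k - b ^ k) ≤ ε := by
  simpa using valuation_prod_sub_prod_le v (range k) (fun _ ↦ a) (fun _ ↦ b) (fun _ ↦ ha)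
    (fun _ ↦ hb) (fun _ ↦ hab)

theorem valuation_pow_le_one {a : K} (ha : v a ≤ 1) (k : ℕ) : v (a ^ k) ≤ 1 := by
  rw [map_pow]
  exact pow_le_one₀ zero_le ha

theorem valuation_prod_pow_le {m : ℕ} {τ : Γ} (h : Fin m → K) (hh : ∀ i, v (h i) ≤ τ)
    (γ : Fin m → ℕ) : v (∏ i, h i ^ γ i) ≤ τ ^ ∑ i, γ i := by
  rw [map_prod, ← prod_pow_eq_pow_sum]
  refine prod_le_prod' fun i _ ↦ ?_
  rw [map_pow]
  exact pow_le_pow_left₀ zero_le (hh i) _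

/-- Truncating an integral polynomial below degree `k + 1` changes its values on a ball of radius
`τ` by at most `τ ^ (k + 1)`. -/
theorem valuation_aeval_sub_truncation_le {m k : ℕ} {τ : Γ} (hτ : τ ≤ 1)
    (Q : MvPolynomial (Fin m) v.integer) (h : Fin m → K) (hh : ∀ i, v (h i) ≤ τ) :
    v (MvPolynomial.aeval h Q - ∑ γ : DeltaIdx m k,
      ((Q.coeff (DeltaIdx.exponent γ) : v.integer) : K) * ∏ i, h i ^ (γ.1 i : ℕ)) ≤ τ ^ (k + 1) := by
  have h1 : MvPolynomial.aeval h Q = ∑ γ ∈ Q.support, ((Q.coeff γ : v.integer) : K) * ∏ i, h i ^ γ i := by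
    rw [MvPolynomial.aeval_def, MvPolynomial.eval₂_eq']
    rfl
  have h2 : ∑ γ : DeltaIdx m k, ((Q.coeff (DeltaIdx.exponent γ) : v.integer) : K) * ∏ i, h i ^ (γ.1 i : ℕ) =
      ∑ γ ∈ Q.support with ∑ i, γ i ≤ k, ((Q.coeff γ : v.integer) : K) * ∏ i, h i ^ γ i := by
    symm
    refine Eq.trans (sum_subset ?_ ?_)
      (sum_map univ ⟨DeltaIdx.exponent, DeltaIdx.exponent_injective⟩
        (fun γ : Fin m →₀ ℕ ↦ ((Q.coeff γ : v.integer) : K) * ∏ i, h i ^ γ i))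
    · intro γ hγ
      obtain ⟨γ', hγ'⟩ := DeltaIdx.exists_exponent_eq γ (mem_filter.1 hγ).2
      simp only [mem_map, mem_univ, true_and]
      exact ⟨γ', hγ'⟩
    · intro γ hγ hn
      simp only [mem_map, mem_univ, true_and] at hγ
      obtain ⟨γ', rfl⟩ := hγ
      have : Q.coeff (DeltaIdx.exponent γ') = 0 := by
        by_contra h0
        exact hn (mem_filter.2 ⟨MvPolynomial.mem_support_iff.2 h0, γ'.2⟩)
      simp [this]
  rw [h1, h2, ← sum_filter_add_sum_filter_not Q.support (fun γ ↦ ∑ i, γ i ≤ k),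
    add_sub_cancel_left]
  refine v.map_sum_le fun γ hγ ↦ ?_
  have hk : k + 1 ≤ ∑ i, γ i := by
    have := (mem_filter.1 hγ).2
    omega
  rw [map_mul]
  exact (mul_le_of_le_one_left' (Q.coeff γ).2).trans
    ((valuation_prod_pow_le v h hh γ).trans (pow_le_pow_right_of_le_one' hτ hk))

theorem valuation_aeval_integer_le_one {m : ℕ} (Q : MvPolynomial (Fin m) v.integer)
    (h : Fin m → K) (hh : ∀ i, v (h i) ≤ 1) : v (MvPolynomial.aeval h Q) ≤ 1 := by
  let h' : Fin m → v.integer := fun i ↦ ⟨h i, hh i⟩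
  have : MvPolynomial.aeval h Q = ((MvPolynomial.aeval h' Q : v.integer) : K) := by
    have := MvPolynomial.aeval_algebraMap_apply K h' Q
    exact this
  rw [this]
  exact (MvPolynomial.aeval h' Q).2

/-- An integral polynomial, recentred at an integral point. -/
theorem exists_integer_polynomial_recentre {m : ℕ} (T : MvPolynomial (Fin m) K)
    (hT : ∀ c, v (T.coeff c) ≤ 1) (y : Fin m → K) (hy : ∀ i, v (y i) ≤ 1) :
    ∃ Q : MvPolynomial (Fin m) v.integer, ∀ x : Fin m → K,
      MvPolynomial.aeval (fun i ↦ x i - y i) Q = MvPolynomial.eval x T := by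
  obtain ⟨T₀, rfl⟩ : ∃ T₀ : MvPolynomial (Fin m) v.integer,
      MvPolynomial.map (algebraMap v.integer K) T₀ = T := by
    have : T ∈ Set.range (MvPolynomial.map (σ := Fin m) (algebraMap v.integer K)) := by
      rw [MvPolynomial.mem_range_map_iff_coeffs_subset]
      intro c hc
      obtain ⟨γ, -, rfl⟩ := MvPolynomial.mem_coeffs_iff.1 hc
      exact ⟨⟨_, hT γ⟩, rfl⟩
    exact this
  refine ⟨MvPolynomial.bind₁ (fun i ↦ MvPolynomial.X i + MvPolynomial.C ⟨y i, hy i⟩) T₀,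
    fun x ↦ ?_⟩
  rw [MvPolynomial.aeval_bind₁, MvPolynomial.eval_map, MvPolynomial.aeval_def]
  congr 1
  funext i
  have : (algebraMap v.integer K) ⟨y i, hy i⟩ = y i := rfl
  simp [this]

variable {v}

theorem IsLift.valuation_eq_one {kt : Subfield K} (hkt : IsLift v kt) {a : K} (ha : a ∈ kt)
    (h0 : a ≠ 0) : v a = 1 := by
  refine le_antisymm (hkt.1 a ha) ?_
  have h1 := hkt.1 _ (kt.inv_mem ha)
  rw [map_inv₀] at h1
  exact (inv_le_one₀ (zero_lt_iff.2 (v.ne_zero_iff.2 h0))).1 h1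

theorem IsLift.valuation_aeval_le_one {kt : Subfield K} (hkt : IsLift v kt) {t : K}
    (ht : v t < 1) (P : Polynomial kt) : v (Polynomial.aeval t P) ≤ 1 := by
  rw [Polynomial.aeval_eq_sum_range]
  refine v.map_sum_le fun i _ ↦ ?_
  rw [Algebra.smul_def, map_mul]
  exact mul_le_one' (hkt.1 _ (P.coeff i).2) (valuation_pow_le_one v ht.le i)

/-- A nonzero polynomial in `t` of degree at most `N` over a lift of the residue field has
valuation at least `|t| ^ N`. -/
theorem IsLift.pow_le_valuation_aeval {kt : Subfield K} (hkt : IsLift v kt) {t : K}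
    (ht : v t < 1) (N : ℕ) (P : Polynomial kt) (hP : P ≠ 0) (hN : P.natDegree ≤ N) :
    v t ^ N ≤ v (Polynomial.aeval t P) := by
  have hdiv : Polynomial.aeval t P = t * Polynomial.aeval t P.divX + (P.coeff 0 : K) := by
    conv_lhs => rw [← Polynomial.X_mul_divX_add P, map_add, map_mul, Polynomial.aeval_X,
      Polynomial.aeval_C]
    rfl
  have hle : v (t * Polynomial.aeval t P.divX) < 1 := by
    rw [map_mul]
    exact (mul_le_of_le_one_right' (hkt.valuation_aeval_le_one ht _)).trans_lt ht
  by_cases h0 : P.coeff 0 = 0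
  · have hPX : P.divX ≠ 0 := by
      intro h
      apply hP
      rw [← Polynomial.X_mul_divX_add P, h, h0]
      simp
    rw [hdiv, h0]
    cases N with
    | zero =>
      exact absurd (by rw [Polynomial.eq_C_of_natDegree_le_zero hN, h0, map_zero]) hP
    | succ N =>
      have := hkt.pow_le_valuation_aeval ht N P.divX hPX
        (by rw [Polynomial.natDegree_divX_eq_natDegree_tsub_one]; omega)
      simp only [ZeroMemClass.coe_zero, add_zero, map_mul]
      rw [pow_succ']
      exact mul_le_mul_right this _
  · have hc : v (P.coeff 0 : K) = 1 := hkt.valuation_eq_one (P.coeff 0).2 (by simpa using h0)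
    rw [hdiv, v.map_add_eq_of_lt_right (by rwa [hc]), hc]
    exact pow_le_one₀ zero_le ht.le

end Valuation

theorem natDegree_det_le_sum {R J : Type*} [CommRing R] [Fintype J] [DecidableEq J]
    (M : Matrix J J (Polynomial R)) (w : J → ℕ) (h : ∀ i j, (M i j).natDegree ≤ w j) :
    M.det.natDegree ≤ ∑ j, w j := by
  rw [Matrix.det_apply]
  refine Polynomial.natDegree_sum_le_of_forall_le _ _ fun σ _ ↦ ?_
  have h1 : (∏ i, M (σ i) i).natDegree ≤ ∑ j, w j :=
    (Polynomial.natDegree_prod_le _ _).trans (sum_le_sum fun i _ ↦ h _ _)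
  rcases Int.units_eq_one_or (Equiv.Perm.sign σ) with h | h <;> simpa [h, Units.smul_def] using h1

theorem ktPoly.exists_polynomial {K : Type*} [Field K] {kt : Subfield K} {t : K} {s : ℕ} {x : K}
    (hx : x ∈ ktPoly kt t s) :
    ∃ q : Polynomial kt, q.natDegree ≤ s ∧ Polynomial.aeval t q = x := by
  obtain ⟨a, ha, rfl⟩ := hx
  refine ⟨∑ i : Fin s, Polynomial.C (⟨a i, ha i⟩ : kt) * Polynomial.X ^ (i : ℕ), ?_, ?_⟩
  · refine Polynomial.natDegree_sum_le_of_forall_le _ _ fun i _ ↦ ?_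
    exact (Polynomial.natDegree_C_mul_X_pow_le _ _).trans i.2.le
  · rw [map_sum]
    refine sum_congr rfl fun i _ ↦ ?_
    rw [map_mul, map_pow, Polynomial.aeval_X, Polynomial.aeval_C]
    rfl

/-- A nonzero determinant of monomials of degree at most `d` at points of `k̃[t]_s` is not too
small. -/
theorem IsLift.pow_le_valuation_det {K Γ : Type*} [Field K] [LinearOrderedCommGroupWithZero Γ]
    {v : Valuation K Γ} {kt : Subfield K} (hkt : IsLift v kt) {t : K} (ht : v t < 1)
    {n d s : ℕ} (z : DeltaIdx n d → Fin n → K) (hz : ∀ j i, z j i ∈ ktPoly kt t s)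
    (hdet : Matrix.det (Matrix.of fun (j β : DeltaIdx n d) ↦ ∏ i, z j i ^ (β.1 i : ℕ)) ≠ 0) :
    v t ^ (s * Vfun n d) ≤
      v (Matrix.det (Matrix.of fun (j β : DeltaIdx n d) ↦ ∏ i, z j i ^ (β.1 i : ℕ))) := by
  choose q hq hqz using fun j i ↦ ktPoly.exists_polynomial (hz j i)
  let M : Matrix (DeltaIdx n d) (DeltaIdx n d) (Polynomial kt) :=
    Matrix.of fun j β ↦ ∏ i, q j i ^ (β.1 i : ℕ)
  have hM : Polynomial.aeval t M.det =
      Matrix.det (Matrix.of fun (j β : DeltaIdx n d) ↦ ∏ i, z j i ^ (β.1 i : ℕ)) := by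
    rw [AlgHom.map_det]
    congr 1
    ext j β
    simp [M, hqz]
  rw [← hM] at hdet ⊢
  refine hkt.pow_le_valuation_aeval ht _ _ (fun h ↦ hdet (by rw [h, map_zero])) ?_
  have hdeg : ∀ j β, (M j β).natDegree ≤ s * ∑ i, (β.1 i : ℕ) := by
    intro j β
    refine (Polynomial.natDegree_prod_le univ (fun i ↦ q j i ^ (β.1 i : ℕ))).trans ?_
    rw [mul_sum]
    refine sum_le_sum fun i _ ↦ Polynomial.natDegree_pow_le.trans ?_
    rw [mul_comm]
    exact Nat.mul_le_mul_right _ (hq j i)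
  refine (natDegree_det_le_sum M _ hdeg).trans_eq ?_
  rw [← mul_sum, sum_degree_deltaIdx, Vfun]

/-- The weights of `Dnum n d` distinct rows sum up to at least `efun n m d`. -/
theorem efun_le_sum_weights {n m d k : ℕ} (hr : rfun m (Dnum n d) = k + 1)
    (f : DeltaIdx n d → DeltaIdx m k ⊕ DeltaIdx n d) (hf : Function.Injective f) :
    efun n m d ≤ ∑ j, Sum.elim (fun γ : DeltaIdx m k ↦ ∑ i, (γ.1 i : ℕ)) (fun _ ↦ k + 1) (f j) := by
  set wt : DeltaIdx m k ⊕ DeltaIdx n d → ℕ :=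
    Sum.elim (fun γ : DeltaIdx m k ↦ ∑ i, (γ.1 i : ℕ)) (fun _ ↦ k + 1) with hwt
  have hwle : ∀ κ, wt κ ≤ k + 1 := by
    rintro (γ | j)
    · exact γ.2.trans (Nat.le_succ k)
    · exact le_rfl
  have hD : Dnum m k ≤ Dnum n d := by
    have : k ∉ {x : ℕ | Dnum n d < Dnum m x} := by
      apply Nat.notMem_of_lt_sInf
      change k < rfun m (Dnum n d)
      omega
    simpa using this
  have hdef : ∑ j, (k + 1 - wt (f j)) ≤ ∑ γ : DeltaIdx m k, (k + 1 - ∑ i, (γ.1 i : ℕ)) := by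
    calc ∑ j, (k + 1 - wt (f j)) = ∑ κ ∈ univ.map ⟨f, hf⟩, (k + 1 - wt κ) := by
          rw [sum_map]; rfl
      _ ≤ ∑ κ, (k + 1 - wt κ) := sum_le_sum_of_subset (subset_univ _)
      _ = _ := by rw [Fintype.sum_sum_type]; simp [hwt]
  have h1 : ∑ j, (k + 1 - wt (f j)) + ∑ j, wt (f j) = (k + 1) * Dnum n d := by
    rw [← sum_add_distrib, sum_congr rfl (fun j _ ↦ Nat.sub_add_cancel (hwle (f j)))]
    simp [Dnum, mul_comm]
  have h2 : ∑ γ : DeltaIdx m k, (k + 1 - ∑ i, (γ.1 i : ℕ)) +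
      ∑ γ : DeltaIdx m k, ∑ i, (γ.1 i : ℕ) = (k + 1) * Dnum m k := by
    rw [← sum_add_distrib, sum_congr rfl (g := fun _ ↦ k + 1)
      (fun γ _ ↦ Nat.sub_add_cancel (γ.2.trans (Nat.le_succ k)))]
    simp [Dnum, mul_comm]
  have h3 : ∑ γ : DeltaIdx m k, ∑ i, (γ.1 i : ℕ) = ∑ l ∈ Icc 1 k, l * Lnum m l := by
    rw [sum_degree_deltaIdx, sum_range_succ', zero_mul, add_zero, range_eq_Ico,
      sum_Ico_add' (fun l ↦ l * Lnum m l) 0 k 1]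
    rfl
  rw [efun, hr, Nat.add_sub_cancel, ← h3]
  have h4 : (k + 1) * (Dnum n d - Dnum m k) + (k + 1) * Dnum m k = (k + 1) * Dnum n d := by
    rw [← mul_add, Nat.sub_add_cancel hD]
  omega

/-- The determinant of monomials of degree at most `d` in a map with `T_r`-approximation, at points
of a small ball, is small. -/
theorem valuation_det_monomials_le {K Γ : Type*} [Field K] [LinearOrderedCommGroupWithZero Γ]
    (v : Valuation K Γ) {d n m : ℕ} (U : Set (Fin m → K)) (hU : ∀ x ∈ U, ∀ i, v (x i) ≤ 1)
    (ψ : (Fin m → K) → (Fin n → K)) (hψO : ∀ x ∈ U, ∀ i, v (ψ x i) ≤ 1)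
    (hψ : ∀ i, TrApprox v U (fun x ↦ ψ x i) (rfun m (Dnum n d)))
    (hr : rfun m (Dnum n d) ≠ 0) (a : K) (ha0 : a ≠ 0) (ha1 : v a ≤ 1)
    (y : Fin m → K) (hy : y ∈ U) (x : DeltaIdx n d → Fin m → K) (hx : ∀ j, x j ∈ U)
    (hxy : ∀ j i, v (x j i - y i) ≤ v a) :
    v (Matrix.det (Matrix.of fun (j β : DeltaIdx n d) ↦ ∏ i, ψ (x j) i ^ (β.1 i : ℕ))) ≤
      v a ^ efun n m d := by
  obtain ⟨k, hk⟩ := Nat.exists_eq_succ_of_ne_zero hr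
  rw [hk] at hψ
  choose T _ hT hTψ using fun i ↦ hψ i y hy
  choose Q hQ using fun i ↦ exists_integer_polynomial_recentre v (T i) (hT i) y (hU y hy)
  let h : DeltaIdx n d → Fin m → K := fun j i ↦ x j i - y i
  let R : DeltaIdx n d → MvPolynomial (Fin m) v.integer := fun β ↦ ∏ i, Q i ^ (β.1 i : ℕ)
  let E : DeltaIdx n d → DeltaIdx n d → K := fun j β ↦ ∏ i, ψ (x j) i ^ (β.1 i : ℕ) -
    ∑ γ : DeltaIdx m k, (((R β).coeff (DeltaIdx.exponent γ) : v.integer) : K) * ∏ i, h j i ^ (γ.1 i : ℕ)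
  have hE : ∀ j β, v (E j β) ≤ v a ^ (k + 1) := by
    intro j β
    have e1 : v (∏ i, ψ (x j) i ^ (β.1 i : ℕ) - MvPolynomial.aeval (h j) (R β)) ≤
        v a ^ (k + 1) := by
      simp only [R, map_prod, map_pow]
      have hQ1 : ∀ i, v (MvPolynomial.aeval (h j) (Q i)) ≤ 1 := fun i ↦
        valuation_aeval_integer_le_one v _ _ fun i ↦ (hxy j i).trans ha1
      refine valuation_prod_sub_prod_le v _ _ _
        (fun i ↦ valuation_pow_le_one v (hψO _ (hx j) i) _)
        (fun i ↦ valuation_pow_le_one v (hQ1 i) _) fun i ↦ ?_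
      refine valuation_pow_sub_pow_le v _ _ _ (hψO _ (hx j) i) (hQ1 i) ?_
      rw [hQ i (x j)]
      exact (hTψ i (x j) (hx j)).trans
        (pow_le_pow_left₀ zero_le (Finset.sup_le fun l _ ↦ hxy j l) _)
    have e2 := valuation_aeval_sub_truncation_le v (k := k) ha1 (R β) (h j) (hxy j)
    have := v.map_add_le e1 e2
    rwa [sub_add_sub_cancel] at this
  have hva : 0 < v a ^ (k + 1) := zero_lt_iff.2 (pow_ne_zero _ (v.ne_zero_iff.2 ha0))
  let c : DeltaIdx n d → DeltaIdx m k ⊕ DeltaIdx n d → K := fun β ↦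
    Sum.elim (fun γ ↦ (((R β).coeff (DeltaIdx.exponent γ) : v.integer) : K)) (fun j ↦ E j β / a ^ (k + 1))
  let w : DeltaIdx m k ⊕ DeltaIdx n d → DeltaIdx n d → K :=
    Sum.elim (fun γ j ↦ ∏ i, h j i ^ (γ.1 i : ℕ)) (fun j' j ↦ if j' = j then a ^ (k + 1) else 0)
  have key := valuation_det_sum_le v ha1
    (Sum.elim (fun γ : DeltaIdx m k ↦ ∑ i, (γ.1 i : ℕ)) (fun _ : DeltaIdx n d ↦ k + 1))
    (efun_le_sum_weights hk) c ?_ w ?_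
  · rw [← Matrix.det_transpose]
    convert key using 3
    ext β j
    simp only [Matrix.transpose_apply, Matrix.of_apply, Fintype.sum_sum_type, c, w, Sum.elim_inl,
      Sum.elim_inr, mul_ite, mul_zero, sum_ite_eq', mem_univ, if_true]
    rw [div_mul_cancel₀ _ (pow_ne_zero _ ha0)]
    simp [E]
  · rintro β (γ | j)
    · exact ((R β).coeff (DeltaIdx.exponent γ)).2
    · simp only [c, Sum.elim_inr, map_div₀, map_pow]
      exact (div_le_one₀ hva).2 (hE j β)
  · rintro (γ | j') j
    · exact valuation_prod_pow_le v (h j) (hxy j) _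
    · simp only [w, Sum.elim_inr]
      split_ifs
      · rw [map_pow]
      · simp

end Helpers

/-- Lemma 4.2: with `μ = D_n(d)`, `r` the integer with `D_m(r−1) ≤ μ < D_m(r)`,
`V = Σ_{k=0}^d k·L_n(k)` and `e = Σ_{k=1}^{r−1} k·L_m(k) + r·(μ − D_m(r−1))`, if
`ψ : U ⊆ O_K^m → O_K^n` satisfies `T_r`-approximation and `α > sV/e`, then for every
fibre `B` of the componentwise reduction `O_K^m → (O_K/(t^α))^m`, the set
`ψ(B ∩ U)_s` is contained in an algebraic hypersurface of degree at most `d`. -/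
theorem points_in_hypersurface {K Γ : Type*} [Field K] [LinearOrderedCommGroupWithZero Γ]
    (v : Valuation K Γ) [CharZero K]
    (hres : ∀ q : ℕ, 0 < q → v (q : K) = 1) [HenselianLocalRing v.integer]
    (t : K) (ht0 : v t ≠ 0) (ht1 : v t < 1)
    (kt : Subfield K) (hkt : IsLift v kt)
    (d n m : ℕ) (hd : 1 ≤ d) (hm : 1 ≤ m) (hmn : m < n)
    (s : ℕ) (hs : 0 < s)
    (U : Set (Fin m → K)) (hU : ∀ x ∈ U, ∀ i, v (x i) ≤ 1)
    (ψ : (Fin m → K) → (Fin n → K))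
    (hψO : ∀ x ∈ U, ∀ i, v (ψ x i) ≤ 1)
    (hψ : ∀ i, TrApprox v U (fun x => ψ x i) (rfun m (Dnum n d)))
    (α : ℕ) (hα : s * Vfun n d < α * efun n m d)
    (b : Fin m → K) (hb : ∀ i, v (b i) ≤ 1) :
    ∃ H : MvPolynomial (Fin n) K, H ≠ 0 ∧ H.totalDegree ≤ d ∧
      ∀ x ∈ U, (∀ i, v (x i - b i) ≤ v t ^ α) →
        (∀ i, ψ x i ∈ ktPoly kt t s) → MvPolynomial.eval (ψ x) H = 0 := by
  classical
  have hr : rfun m (Dnum n d) ≠ 0 := by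
    intro h0
    simp [efun, h0] at hα
  let S : Set (Fin m → K) :=
    {x | x ∈ U ∧ (∀ i, v (x i - b i) ≤ v t ^ α) ∧ ∀ i, ψ x i ∈ ktPoly kt t s}
  have hτ : v t ^ α ≤ 1 := pow_le_one₀ zero_le ht1.le
  have hdet : ∀ x : DeltaIdx n d → S, Matrix.det (Matrix.of fun j (β : DeltaIdx n d) ↦
      ∏ i, ψ (x j) i ^ (β.1 i : ℕ)) = 0 := by
    intro x
    by_contra hne
    have hlow := hkt.pow_le_valuation_det ht1 (fun j ↦ ψ (x j)) (fun j ↦ (x j).2.2.2) hne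
    let j₀ : DeltaIdx n d := ⟨fun _ ↦ 0, by simp⟩
    have hup := valuation_det_monomials_le v U hU ψ hψO hψ hr (t ^ α)
      (pow_ne_zero _ (v.ne_zero_iff.1 ht0)) (by rwa [map_pow]) (x j₀) (x j₀).2.1
      (fun j ↦ x j) (fun j ↦ (x j).2.1) fun j i ↦ by
        rw [map_pow, ← sub_sub_sub_cancel_right _ _ (b i)]
        exact v.map_sub_le ((x j).2.2.1 i) ((x j₀).2.2.1 i)
    rw [map_pow, ← pow_mul] at hup
    exact absurd (hlow.trans hup)
      (not_le.2 (pow_lt_pow_right_of_lt_one₀ (zero_lt_iff.2 ht0) ht1 hα))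
  obtain ⟨a, ha, hrel⟩ := exists_linear_relation_of_det_eq_zero
    (fun (x : S) (β : DeltaIdx n d) ↦ ∏ i, ψ x i ^ (β.1 i : ℕ)) hdet
  refine ⟨∑ β : DeltaIdx n d, MvPolynomial.monomial (DeltaIdx.exponent β) (a β), ?_, ?_, ?_⟩
  · intro h0
    apply ha
    funext β
    have := congrArg (MvPolynomial.coeff (DeltaIdx.exponent β)) h0
    simpa [MvPolynomial.coeff_sum, MvPolynomial.coeff_monomial,
      DeltaIdx.exponent_injective.eq_iff] using this
  · refine (MvPolynomial.totalDegree_finsetSum _ _).trans (Finset.sup_le fun β _ ↦ ?_)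
    refine (MvPolynomial.totalDegree_monomial_le _ _).trans ?_
    rw [Finsupp.sum_fintype _ _ fun _ ↦ rfl]
    exact β.2
  · intro x hxU hxb hxs
    have := hrel ⟨x, hxU, hxb, hxs⟩
    rw [map_sum, ← this]
    refine Finset.sum_congr rfl fun β _ ↦ ?_
    rw [MvPolynomial.eval_monomial, Finsupp.prod_fintype _ _ fun _ ↦ pow_zero _]
    rfl
end

section
/- Let k be a field of characteristic zero. In the formal power series ring k[[X]], the elements X and exp(X) = Σ_{i≥0} X^i/i! are algebraically independent over k; equivalently, there is no nonzero polynomial f ∈ k[x, y] in two variables such that f(X, exp(X)) = 0 in k[[X]]. -/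
open PowerSeries in
/-- Differentiating `∑ pⱼ eʲ` and subtracting `c` times it again gives a sum of this form. -/
theorem sum_coe_mul_exp_pow_derivative_sub_smul {k : Type*} [Field k] [CharZero k]
    (s : Finset ℕ) (p : ℕ → Polynomial k) (c : k) :
    ∑ j ∈ s, ((Polynomial.derivative (p j) + Polynomial.C ((j : k) - c) * p j :
        Polynomial k) : PowerSeries k) * exp k ^ j =
      derivative k (∑ j ∈ s, (p j : PowerSeries k) * exp k ^ j) -
        C c * ∑ j ∈ s, (p j : PowerSeries k) * exp k ^ j := by
  rw [map_sum, Finset.mul_sum, ← Finset.sum_sub_distrib]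
  refine Finset.sum_congr rfl fun j _ => ?_
  rw [Derivation.leibniz, derivative_pow, derivative_exp, derivative_coe]
  rcases j with _ | j
  · simp
    ring
  · have hcast : ((j : Polynomial k) : PowerSeries k) = j :=
      map_natCast Polynomial.coeToPowerSeries.ringHom j
    simp [pow_succ, hcast]
    ring

/-- The operator `p ↦ p' + c p` is injective on polynomials when `c ≠ 0`. -/
theorem Polynomial.eq_zero_of_derivative_add_C_mul_eq_zero {k : Type*} [Field k]
    {c : k} (hc : c ≠ 0) {p : Polynomial k}
    (h : Polynomial.derivative p + Polynomial.C c * p = 0) : p = 0 := by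
  by_contra hp
  have hlt := Polynomial.degree_derivative_lt hp
  have hd : (Polynomial.derivative p).degree = p.degree := by
    rw [eq_neg_of_add_eq_zero_left h, Polynomial.degree_neg, Polynomial.degree_C_mul hc]
  exact hlt.ne hd

open PowerSeries in
/-- The powers of the exponential series are linearly independent over the polynomials. -/
theorem eq_zero_of_sum_coe_mul_exp_pow_eq_zero {k : Type*} [Field k] [CharZero k]
    (m : ℕ) (p : ℕ → Polynomial k)
    (h : ∑ j ∈ Finset.range m, (p j : PowerSeries k) * exp k ^ j = 0) :
    ∀ j < m, p j = 0 := by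
  induction m generalizing p with
  | zero => simp
  | succ m ih =>
    have key : ∀ (N : ℕ) (p : ℕ → Polynomial k), Polynomial.derivative^[N] (p m) = 0 →
        ∑ j ∈ Finset.range (m + 1), (p j : PowerSeries k) * exp k ^ j = 0 →
        ∀ j < m, p j = 0 := by
      intro N
      induction N with
      | zero =>
        intro p hN hp
        rw [Function.iterate_zero_apply] at hN
        exact ih p (by simpa [Finset.sum_range_succ, hN] using hp)
      | succ N ihN =>
        intro p hN hp j hj
        have hq := sum_coe_mul_exp_pow_derivative_sub_smul (Finset.range (m + 1)) p (m : k)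
        rw [hp, map_zero, mul_zero, sub_zero] at hq
        refine Polynomial.eq_zero_of_derivative_add_C_mul_eq_zero
          (sub_ne_zero.mpr (Nat.cast_injective.ne hj.ne))
          (ihN _ ?_ hq j hj)
        simpa using hN
    have hlow := key _ p (Polynomial.iterate_derivative_eq_zero (Nat.lt_succ_self _)) h
    have hexp : exp k ≠ 0 := (isUnit_exp k).ne_zero
    rw [Finset.sum_range_succ, Finset.sum_eq_zero fun j hj => by
      rw [hlow j (Finset.mem_range.mp hj), Polynomial.coe_zero, zero_mul], zero_add] at h
    have htop : p m = 0 := by simpa [hexp] using h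
    intro j hj
    rcases Nat.lt_succ_iff_lt_or_eq.mp hj with hj | rfl
    · exact hlow j hj
    · exact htop

/-- In `k[[X]]` over a field `k` of characteristic zero, `X` and
`exp(X) = Σ_{i≥0} X^i/i!` are algebraically independent over `k`: no nonzero polynomial
`f ∈ k[x, y]` satisfies `f(X, exp(X)) = 0`. -/
theorem X_exp_algebraically_independent (k : Type*) [Field k] [CharZero k]
    (f : MvPolynomial (Fin 2) k)
    (hf : MvPolynomial.aeval
      ![(PowerSeries.X : PowerSeries k), PowerSeries.exp k] f = 0) :
    f = 0 := by
  obtain ⟨g, rfl⟩ := (Polynomial.Bivariate.equivMvPolynomial k).surjective f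
  have hcomp : ((MvPolynomial.aeval
      ![(PowerSeries.X : PowerSeries k), PowerSeries.exp k]).toRingHom).comp
        (Polynomial.Bivariate.equivMvPolynomial k).toRingHom =
      Polynomial.eval₂RingHom Polynomial.coeToPowerSeries.ringHom (PowerSeries.exp k) := by
    ext : 2 <;> simp
    ext : 1
    simp
  have hg : g.eval₂ Polynomial.coeToPowerSeries.ringHom (PowerSeries.exp k) = 0 :=
    (DFunLike.congr_fun hcomp g).symm.trans hf
  rw [Polynomial.eval₂_eq_sum_range] at hg
  have hcoeff := eq_zero_of_sum_coe_mul_exp_pow_eq_zero _ g.coeff hg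
  have hzero : g = 0 :=
    Polynomial.leadingCoeff_eq_zero.mp (hcoeff g.natDegree (Nat.lt_succ_self _))
  rw [hzero, map_zero]
end
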